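/- For all γ > 0, t > 0 and x ≥ 0 one has 2 ∫_x^∞ g_{0,γ}(t,u) du + γ g_{0,γ}(t,x) = erfc( x/√(2t) ). -/

import Mathlib

open Real Set MeasureTheory

/-- The complementary error function `erfc(u) = (2/√π) ∫_u^∞ e^{-z²} dz`. -/
noncomputable def erfc (u : ℝ) : ℝ :=
  (2 / Real.sqrt Real.pi) * ∫ z in Set.Ioi u, Real.exp (-z ^ 2)

/-- `g_{0,γ}(t,x) = (1/γ) exp(2x/γ + 2t/γ²) erfc(x/√(2t) + √(2t)/γ)`. -/
noncomputable def g0 (γ t x : ℝ) : ℝ :=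
  (1 / γ) * Real.exp (2 * x / γ + 2 * t / γ ^ 2) *
    erfc (x / Real.sqrt (2 * t) + Real.sqrt (2 * t) / γ)

lemma integrable_exp_neg_sq : Integrable fun z : ℝ => Real.exp (-z ^ 2) := by
  simpa using integrable_exp_neg_mul_sq (b := 1) one_pos

lemma erfc_nonneg (u : ℝ) : 0 ≤ erfc u :=
  mul_nonneg (by positivity) (integral_nonneg fun _ => (Real.exp_pos _).le)

lemma hasDerivAt_erfc (u : ℝ) :
    HasDerivAt erfc (-(2 / Real.sqrt Real.pi * Real.exp (-u ^ 2))) u := by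
  have hsplit : erfc = fun v => (2 / Real.sqrt Real.pi) *
      ((∫ z in Set.Ioi 0, Real.exp (-z ^ 2)) - ∫ z in (0 : ℝ)..v, Real.exp (-z ^ 2)) := by
    funext v
    have h := intervalIntegral.integral_Ioi_sub_Ioi' (μ := volume) (a := 0) (b := v)
      integrable_exp_neg_sq.integrableOn integrable_exp_neg_sq.integrableOn
    rw [erfc, ← h, sub_sub_cancel]
  have hcont : Continuous fun z : ℝ => Real.exp (-z ^ 2) := by fun_prop
  rw [hsplit]
  exact (((hcont.integral_hasStrictDerivAt 0 u).hasDerivAt.const_sub _).const_mul _).congr_deriv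
    (mul_neg _ _)

/-- The Mills ratio bound for the complementary error function. -/
lemma erfc_le_exp_neg_sq_div {u : ℝ} (hu : 0 < u) :
    erfc u ≤ 1 / Real.sqrt Real.pi * (Real.exp (-u ^ 2) / u) := by
  have hneg : -(2 * u) < 0 := by linarith
  have hle : ∫ z in Set.Ioi u, Real.exp (-z ^ 2) ≤
      ∫ z in Set.Ioi u, Real.exp (u ^ 2) * Real.exp (-(2 * u) * z) := by
    refine integral_mono integrable_exp_neg_sq.integrableOn
      ((integrableOn_exp_mul_Ioi hneg u).const_mul _) fun z => ?_
    simp only [← Real.exp_add]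
    exact Real.exp_le_exp.2 (by nlinarith [sq_nonneg (z - u)])
  have hval : ∫ z in Set.Ioi u, Real.exp (u ^ 2) * Real.exp (-(2 * u) * z) =
      Real.exp (-u ^ 2) / (2 * u) := by
    rw [integral_const_mul, integral_exp_mul_Ioi hneg, neg_div_neg_eq, mul_div_assoc',
      ← Real.exp_add]
    congr 2
    ring
  calc erfc u ≤ 2 / Real.sqrt Real.pi * (Real.exp (-u ^ 2) / (2 * u)) := by
        rw [erfc, ← hval]
        gcongr
    _ = 1 / Real.sqrt Real.pi * (Real.exp (-u ^ 2) / u) := by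
        field_simp

lemma tendsto_erfc_atTop : Filter.Tendsto erfc Filter.atTop (nhds 0) := by
  have hlim : Filter.Tendsto (fun u : ℝ => 1 / Real.sqrt Real.pi * u⁻¹)
      Filter.atTop (nhds 0) := by
    simpa using tendsto_inv_atTop_zero.const_mul (1 / Real.sqrt Real.pi)
  refine tendsto_of_tendsto_of_tendsto_of_le_of_le' tendsto_const_nhds hlim
    (.of_forall erfc_nonneg) ?_
  filter_upwards [Filter.eventually_gt_atTop 0] with u hu
  refine (erfc_le_exp_neg_sq_div hu).trans ?_
  rw [← one_div u]
  gcongr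
  exact Real.exp_le_one_iff.2 (by nlinarith)

lemma sq_div_sqrt_add {γ t : ℝ} (hγ : 0 < γ) (ht : 0 < t) (u : ℝ) :
    (u / Real.sqrt (2 * t) + Real.sqrt (2 * t) / γ) ^ 2 =
      (u / Real.sqrt (2 * t)) ^ 2 + (2 * u / γ + 2 * t / γ ^ 2) := by
  have hs : 0 < Real.sqrt (2 * t) := by positivity
  have hsq : Real.sqrt (2 * t) ^ 2 = 2 * t := Real.sq_sqrt (by positivity)
  have hcross : 2 * (u / Real.sqrt (2 * t)) * (Real.sqrt (2 * t) / γ) = 2 * u / γ := by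
    field_simp
  rw [add_sq, hcross, div_pow (Real.sqrt (2 * t)), hsq, add_assoc]

lemma g0_nonneg {γ : ℝ} (hγ : 0 < γ) (t u : ℝ) : 0 ≤ g0 γ t u :=
  mul_nonneg (by positivity) (erfc_nonneg _)

lemma tendsto_mul_g0_atTop {γ t : ℝ} (hγ : 0 < γ) (ht : 0 < t) :
    Filter.Tendsto (fun u => γ * g0 γ t u) Filter.atTop (nhds 0) := by
  have hs : 0 < Real.sqrt (2 * t) := by positivity
  have harg : Filter.Tendsto (fun u : ℝ => u / Real.sqrt (2 * t) + Real.sqrt (2 * t) / γ)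
      Filter.atTop Filter.atTop :=
    Filter.tendsto_atTop_add_const_right _ _ (Filter.tendsto_id.atTop_div_const hs)
  have hlim : Filter.Tendsto (fun u : ℝ =>
      1 / Real.sqrt Real.pi * (u / Real.sqrt (2 * t) + Real.sqrt (2 * t) / γ)⁻¹)
      Filter.atTop (nhds 0) := by
    simpa using (tendsto_inv_atTop_zero.comp harg).const_mul (1 / Real.sqrt Real.pi)
  refine tendsto_of_tendsto_of_tendsto_of_le_of_le' tendsto_const_nhds hlim
    (.of_forall fun u => mul_nonneg hγ.le (g0_nonneg hγ t u)) ?_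
  filter_upwards [Filter.eventually_gt_atTop 0] with u hu
  have hsq := sq_div_sqrt_add hγ ht u
  set v := u / Real.sqrt (2 * t) + Real.sqrt (2 * t) / γ with hv
  have hv0 : 0 < v := by positivity
  calc γ * g0 γ t u = Real.exp (2 * u / γ + 2 * t / γ ^ 2) * erfc v := by
        rw [g0, ← hv]
        field_simp
    _ ≤ Real.exp (2 * u / γ + 2 * t / γ ^ 2) *
          (1 / Real.sqrt Real.pi * (Real.exp (-v ^ 2) / v)) := by
        gcongr
        exact erfc_le_exp_neg_sq_div hv0
    _ = 1 / Real.sqrt Real.pi * (Real.exp (2 * u / γ + 2 * t / γ ^ 2 + -v ^ 2) * v⁻¹) := by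
        rw [Real.exp_add _ (-v ^ 2)]
        ring
    _ ≤ 1 / Real.sqrt Real.pi * (1 * v⁻¹) := by
        gcongr
        exact Real.exp_le_one_iff.2 (by nlinarith [sq_nonneg (u / Real.sqrt (2 * t))])
    _ = 1 / Real.sqrt Real.pi * v⁻¹ := by rw [one_mul]

lemma hasDerivAt_mul_g0_sub_erfc {γ t : ℝ} (hγ : 0 < γ) (ht : 0 < t) (u : ℝ) :
    HasDerivAt (fun y => γ * g0 γ t y - erfc (y / Real.sqrt (2 * t))) (2 * g0 γ t u) u := by
  have hlin : HasDerivAt (fun y => y / Real.sqrt (2 * t)) (1 / Real.sqrt (2 * t)) u :=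
    (hasDerivAt_id u).div_const _
  have hexp : HasDerivAt (fun y => Real.exp (2 * y / γ + 2 * t / γ ^ 2))
      (Real.exp (2 * u / γ + 2 * t / γ ^ 2) * (2 * 1 / γ)) u :=
    ((((hasDerivAt_id u).const_mul 2).div_const γ).add_const _).exp
  have hshift := (hasDerivAt_erfc _).comp u (hlin.add_const (Real.sqrt (2 * t) / γ))
  have herfc := (hasDerivAt_erfc _).comp u hlin
  have hcancel : Real.exp (2 * u / γ + 2 * t / γ ^ 2) *
      Real.exp (-(u / Real.sqrt (2 * t) + Real.sqrt (2 * t) / γ) ^ 2) =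
      Real.exp (-(u / Real.sqrt (2 * t)) ^ 2) := by
    rw [← Real.exp_add, sq_div_sqrt_add hγ ht]
    congr 1
    ring
  refine ((((hexp.const_mul (1 / γ)).mul hshift).const_mul γ).sub herfc).congr_deriv ?_
  simp only [Function.comp_apply]
  rw [g0, ← hcancel]
  field_simp
  ring

/-- For all `γ > 0`, `t > 0` and `x ≥ 0` one has
`2 ∫_x^∞ g_{0,γ}(t,u) du + γ g_{0,γ}(t,x) = erfc(x/√(2t))`. -/
theorem g0_mass_identity (γ t x : ℝ) (hγ : 0 < γ) (ht : 0 < t) (hx : 0 ≤ x) :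
    2 * (∫ u in Set.Ioi x, g0 γ t u) + γ * g0 γ t x = erfc (x / Real.sqrt (2 * t)) := by
  have hlim : Filter.Tendsto (fun y => γ * g0 γ t y - erfc (y / Real.sqrt (2 * t)))
      Filter.atTop (nhds 0) := by
    have hs : 0 < Real.sqrt (2 * t) := by positivity
    simpa using (tendsto_mul_g0_atTop hγ ht).sub
      (tendsto_erfc_atTop.comp (Filter.tendsto_id.atTop_div_const hs))
  have hint := integral_Ioi_of_hasDerivAt_of_nonneg' (a := x)
    (fun u _ => hasDerivAt_mul_g0_sub_erfc hγ ht u)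
    (fun u _ => mul_nonneg zero_le_two (g0_nonneg hγ t u)) hlim
  rw [integral_const_mul] at hint
  linarith
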